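/- In the normal linear regression model y = Xβ + ε with ε ~ N_n(0, σ²V) and prior β ~ N_p(0, σ²W), let A = V^{−1} − V^{−1} X (X^t V^{−1} X + W^{−1})^{−1} X^t V^{−1} and σ̂² = y^t P y/n with P = V^{−1} − V^{−1} X (X^t V^{−1} X)^{−1} X^t V^{−1}. Then E_π E_ω( y^t A y / σ̂² ) = n + n/(σ²(n − p − 2)) · { σ² tr[(X^t V^{−1} X + W^{−1})^{−1} W^{−1}] + σ² tr[X^t V^{−1} X (X^t V^{−1} X + W^{−1})^{−1}] }, and consequently, if n^{−1} X^t V^{−1} X converges to a positive definite matrix as n → ∞ (with p fixed), then E_π E_ω( y^t A y / σ̂² − n ) → p. -/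

import Mathlib

open MeasureTheory Matrix Real Filter Topology

/-- Density of the `n`-variate normal distribution with mean vector `μ` and
covariance matrix `S`, with respect to the Lebesgue measure on `Fin n → ℝ`. -/
noncomputable def gaussPdf {n : ℕ} (μ : Fin n → ℝ) (S : Matrix (Fin n) (Fin n) ℝ)
    (x : Fin n → ℝ) : ℝ :=
  ((2 * π) ^ n * S.det) ^ (-(1 : ℝ) / 2) *
    Real.exp (-((x - μ) ⬝ᵥ S⁻¹.mulVec (x - μ)) / 2)

/-- `A_n = V⁻¹ - V⁻¹X(XᵀV⁻¹X + W⁻¹)⁻¹XᵀV⁻¹`. -/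
noncomputable def Amat {n p : ℕ} (X : Matrix (Fin n) (Fin p) ℝ)
    (V : Matrix (Fin n) (Fin n) ℝ) (W : Matrix (Fin p) (Fin p) ℝ) :
    Matrix (Fin n) (Fin n) ℝ :=
  V⁻¹ - V⁻¹ * X * (Xᵀ * V⁻¹ * X + W⁻¹)⁻¹ * Xᵀ * V⁻¹

/-- `P_n = V⁻¹ - V⁻¹X(XᵀV⁻¹X)⁻¹XᵀV⁻¹`. -/
noncomputable def Pmat {n p : ℕ} (X : Matrix (Fin n) (Fin p) ℝ)
    (V : Matrix (Fin n) (Fin n) ℝ) : Matrix (Fin n) (Fin n) ℝ :=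
  V⁻¹ - V⁻¹ * X * (Xᵀ * V⁻¹ * X)⁻¹ * Xᵀ * V⁻¹

/-- `E_π E_ω (yᵀA_n y / σ̂²)`: the expectation of `yᵀA_n y / σ̂²` over
`y ~ N_n(X_n β, σ²V_n)` given `β`, further averaged over the prior
`β ~ N_p(0, σ²W)`. -/
noncomputable def EpiEom (p : ℕ) (X : (n : ℕ) → Matrix (Fin n) (Fin p) ℝ)
    (V : (n : ℕ) → Matrix (Fin n) (Fin n) ℝ) (W : Matrix (Fin p) (Fin p) ℝ)
    (σ2 : ℝ) (n : ℕ) : ℝ :=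
  ∫ β : Fin p → ℝ,
    (∫ y : Fin n → ℝ,
      ((y ⬝ᵥ (Amat (X n) (V n) W).mulVec y)
          / (y ⬝ᵥ (Pmat (X n) (V n)).mulVec y / n))
        * gaussPdf ((X n).mulVec β) (σ2 • V n) y)
      * gaussPdf 0 (σ2 • W) β

open ProbabilityTheory

/-- The standard Gaussian measure on `ι → ℝ`. -/
noncomputable def piGaussian (ι : Type*) [Fintype ι] : Measure (ι → ℝ) :=
  Measure.pi fun _ => gaussianReal 0 1

instance {ι : Type*} [Fintype ι] : IsProbabilityMeasure (piGaussian ι) := by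
  unfold piGaussian; infer_instance

lemma prod_gaussianPDFReal {ι : Type*} [Fintype ι] (z : ι → ℝ) :
    ∏ i, gaussianPDFReal 0 1 (z i)
      = (√(2 * π))⁻¹ ^ Fintype.card ι * Real.exp (-(z ⬝ᵥ z) / 2) := by
  simp only [gaussianPDFReal, Finset.prod_mul_distrib, ← Real.exp_sum, dotProduct]
  simp [neg_div, Finset.sum_div, sq]

lemma piGaussian_eq_withDensity (ι : Type*) [Fintype ι] :
    piGaussian ι = (volume : Measure (ι → ℝ)).withDensity
      fun z => ENNReal.ofReal (∏ i, gaussianPDFReal 0 1 (z i)) := by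
  refine (Measure.pi_eq fun s hs => ?_)
  have h0 : ∀ z : ι → ℝ, 0 ≤ ∏ i, gaussianPDFReal 0 1 (z i) := fun z =>
    Finset.prod_nonneg fun i _ => gaussianPDFReal_nonneg _ _ _
  rw [withDensity_apply _ (MeasurableSet.univ_pi hs), volume_pi, Measure.restrict_pi_pi,
    ← ofReal_integral_eq_lintegral_ofReal _ (.of_forall h0), integral_fintype_prod_eq_prod,
    ENNReal.ofReal_prod_of_nonneg]
  · simp_rw [gaussianReal_apply_eq_integral _ one_ne_zero]
  · exact fun i _ => integral_nonneg fun x => gaussianPDFReal_nonneg _ _ _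
  · exact Integrable.fintype_prod fun i => (integrable_gaussianPDFReal 0 1).restrict

lemma measurable_prod_gaussianPDFReal {ι : Type*} [Fintype ι] :
    Measurable fun z : ι → ℝ => ∏ i, gaussianPDFReal 0 1 (z i) := by
  fun_prop

lemma integral_piGaussian {ι : Type*} [Fintype ι] (f : (ι → ℝ) → ℝ) :
    ∫ z, f z ∂piGaussian ι = ∫ z, (∏ i, gaussianPDFReal 0 1 (z i)) * f z := by
  have h0 : ∀ z : ι → ℝ, 0 ≤ ∏ i, gaussianPDFReal 0 1 (z i) := fun z =>
    Finset.prod_nonneg fun i _ => gaussianPDFReal_nonneg _ _ _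
  rw [piGaussian_eq_withDensity, integral_withDensity_eq_integral_toReal_smul
    measurable_prod_gaussianPDFReal.ennreal_ofReal (.of_forall fun _ => ENNReal.ofReal_lt_top)]
  simp [ENNReal.toReal_ofReal (h0 _)]

lemma integrable_piGaussian_iff {ι : Type*} [Fintype ι] {f : (ι → ℝ) → ℝ} :
    Integrable f (piGaussian ι) ↔
      Integrable fun z => (∏ i, gaussianPDFReal 0 1 (z i)) * f z := by
  have h0 : ∀ z : ι → ℝ, 0 ≤ ∏ i, gaussianPDFReal 0 1 (z i) := fun z =>
    Finset.prod_nonneg fun i _ => gaussianPDFReal_nonneg _ _ _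
  rw [piGaussian_eq_withDensity, integrable_withDensity_iff_integrable_smul'
    measurable_prod_gaussianPDFReal.ennreal_ofReal (.of_forall fun _ => ENNReal.ofReal_lt_top)]
  simp [ENNReal.toReal_ofReal (h0 _)]

/-- Integration against a Gaussian density as integration of an affine image of a standard
Gaussian vector. -/
lemma integral_mul_gaussPdf {n : ℕ} (f : (Fin n → ℝ) → ℝ) (μ : Fin n → ℝ)
    {S T : Matrix (Fin n) (Fin n) ℝ} (hT : T * Tᵀ = S) (hS : S.det ≠ 0) :
    ∫ y, f y * gaussPdf μ S y = ∫ z, f (μ + T *ᵥ z) ∂piGaussian (Fin n) := by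
  have hdet : S.det = T.det ^ 2 := by rw [← hT, det_mul, det_transpose, sq]
  have hTdet : T.det ≠ 0 := fun h => hS (by simp [hdet, h])
  have hTu : IsUnit T.det := hTdet.isUnit
  have hSinv : Tᵀ * S⁻¹ * T = 1 := by
    rw [← hT, Matrix.mul_inv_rev, ← Matrix.mul_assoc, mul_nonsing_inv _ (by rwa [det_transpose]),
      Matrix.one_mul, nonsing_inv_mul _ hTu]
  have hcov : ∀ g : (Fin n → ℝ) → ℝ, ∫ y, g y = |T.det| * ∫ z, g (μ + T *ᵥ z) := by
    intro g
    rw [← integral_add_left_eq_self g μ]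
    have hemb : MeasurableEmbedding (toLin' T) := by
      have h : Function.Injective (toLin' T) := by
        intro a b hab
        simpa [toLin'_apply] using
          mulVec_injective_iff_isUnit.mpr ((isUnit_iff_isUnit_det T).mpr hTu) hab
      exact (LinearMap.isClosedEmbedding_of_injective (LinearMap.ker_eq_bot.mpr h)).measurableEmbedding
    have h := hemb.integral_map (μ := volume) fun y => g (μ + y)
    rw [Real.map_matrix_volume_pi_eq_smul_volume_pi hTdet, integral_smul_measure] at h
    simp only [toLin'_apply, ENNReal.toReal_ofReal (abs_nonneg _), smul_eq_mul] at h
    rw [← h, abs_inv, mul_inv_cancel_left₀ (abs_ne_zero.mpr hTdet)]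
  rw [hcov, integral_piGaussian, ← integral_const_mul]
  congr 1 with z
  have hq : (μ + T *ᵥ z - μ) ⬝ᵥ S⁻¹ *ᵥ (μ + T *ᵥ z - μ) = z ⬝ᵥ z := by
    rw [add_sub_cancel_left, dotProduct_mulVec, vecMul_mulVec, ← dotProduct_mulVec, mulVec_mulVec,
       hSinv, one_mulVec]
  have hc : |T.det| * ((2 * π) ^ n * S.det) ^ (-(1 : ℝ) / 2) = (√(2 * π))⁻¹ ^ n := by
    have h2 : ((2 * π) ^ n * S.det) = (√(2 * π) ^ n * |T.det|) ^ 2 := by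
      rw [mul_pow (_ ^ n), sq_abs, hdet, ← pow_mul, mul_comm n 2, pow_mul,
        Real.sq_sqrt (by positivity)]
    have h3 : 0 < √(2 * π) ^ n * |T.det| := by positivity
    rw [h2, ← Real.rpow_natCast, ← Real.rpow_mul h3.le]
    rw [show ((2 : ℕ) : ℝ) * (-1 / 2) = -1 by norm_num, Real.rpow_neg_one, mul_inv, inv_pow,
      mul_comm (_⁻¹), mul_inv_cancel_left₀ (abs_ne_zero.mpr hTdet)]
  rw [gaussPdf, hq, prod_gaussianPDFReal, Fintype.card_fin, ← hc]
  ring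

lemma memLp_eval_piGaussian {ι : Type*} [Fintype ι] (i : ι) :
    MemLp (fun z : ι → ℝ => z i) 2 (piGaussian ι) :=
  (memLp_id_gaussianReal 2).comp_measurePreserving (measurePreserving_eval _ i)

lemma integral_eval_piGaussian {ι : Type*} [Fintype ι] (i : ι) :
    ∫ z, z i ∂piGaussian ι = 0 := by
  rw [piGaussian, integral_eval, integral_id_gaussianReal]

lemma integrable_mul_piGaussian {ι : Type*} [Fintype ι] (i j : ι) :
    Integrable (fun z : ι → ℝ => z i * z j) (piGaussian ι) :=
  (memLp_eval_piGaussian i).integrable_mul (memLp_eval_piGaussian j)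

lemma integral_mul_piGaussian {ι : Type*} [Fintype ι] [DecidableEq ι] (i j : ι) :
    ∫ z, z i * z j ∂piGaussian ι = (1 : Matrix ι ι ℝ) i j := by
  by_cases hij : i = j
  · subst hij
    have h := variance_id_gaussianReal (μ := 0) (v := 1)
    rw [variance_eq_integral aemeasurable_id] at h
    simp only [id, integral_id_gaussianReal, sub_zero] at h
    rw [one_apply_eq]
    refine (integral_comp_eval (μ := fun _ : ι => gaussianReal 0 1) (i := i)
      (f := fun x : ℝ => x * x) (by fun_prop)).trans ?_
    simpa [sq] using h
  · have hind : iIndepFun (fun (i : ι) (z : ι → ℝ) => z i) (piGaussian ι) :=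
      iIndepFun_pi (X := fun _ => id) fun _ => aemeasurable_id
    rw [one_apply_ne hij]
    have h := (hind.indepFun hij).integral_fun_mul_eq_mul_integral
      (memLp_eval_piGaussian i).1 (memLp_eval_piGaussian j).1
    rw [h, integral_eval_piGaussian, zero_mul]

/-- A quadratic form of an affine image of a standard Gaussian vector. -/
lemma integrable_quadratic_piGaussian_and_integral {ι κ : Type*} [Fintype ι] [Fintype κ]
    (a : κ → ℝ) (C : Matrix κ ι ℝ) (M : Matrix κ κ ℝ) :
    Integrable (fun u => (a + C *ᵥ u) ⬝ᵥ M *ᵥ (a + C *ᵥ u)) (piGaussian ι) ∧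
    ∫ u, (a + C *ᵥ u) ⬝ᵥ M *ᵥ (a + C *ᵥ u) ∂piGaussian ι
      = a ⬝ᵥ M *ᵥ a + (Cᵀ * M * C).trace := by
  classical
  set l : ι → ℝ := a ᵥ* (M * C) + (M *ᵥ a) ᵥ* C with hl
  set K : Matrix ι ι ℝ := Cᵀ * M * C with hK
  have hexp : (fun u : ι → ℝ => (a + C *ᵥ u) ⬝ᵥ M *ᵥ (a + C *ᵥ u))
      = fun u => a ⬝ᵥ M *ᵥ a + ∑ i, l i * u i + ∑ i, ∑ j, K i j * (u i * u j) := by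
    funext u
    have h1 : ∑ i, l i * u i = a ⬝ᵥ M *ᵥ C *ᵥ u + C *ᵥ u ⬝ᵥ M *ᵥ a := by
      change l ⬝ᵥ u = _
      rw [hl, add_dotProduct, ← dotProduct_mulVec, ← dotProduct_mulVec, mulVec_mulVec,
        dotProduct_comm (M *ᵥ a)]
    have h2 : ∑ i, ∑ j, K i j * (u i * u j) = C *ᵥ u ⬝ᵥ M *ᵥ C *ᵥ u := by
      rw [dotProduct_mulVec, vecMul_mulVec, ← dotProduct_mulVec, mulVec_mulVec, ← hK]
      simp only [dotProduct, mulVec, Finset.mul_sum]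
      exact Finset.sum_congr rfl fun i _ => Finset.sum_congr rfl fun j _ => by ring
    rw [h1, h2, mulVec_add, add_dotProduct, dotProduct_add, dotProduct_add]
    ring
  have hi1 : ∀ i ∈ Finset.univ, Integrable (fun u : ι → ℝ => l i * u i) (piGaussian ι) :=
    fun i _ => ((memLp_eval_piGaussian i).integrable one_le_two).const_mul _
  have hi2 : ∀ i, ∀ j ∈ Finset.univ,
      Integrable (fun u : ι → ℝ => K i j * (u i * u j)) (piGaussian ι) :=
    fun i j _ => (integrable_mul_piGaussian i j).const_mul _
  have hI1 := integrable_finsetSum _ hi1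
  have hi3 : ∀ i ∈ Finset.univ,
      Integrable (fun u : ι → ℝ => ∑ j, K i j * (u i * u j)) (piGaussian ι) :=
    fun i _ => integrable_finsetSum _ (hi2 i)
  have hI2 := integrable_finsetSum _ hi3
  have hI3 : Integrable (fun u : ι → ℝ => a ⬝ᵥ M *ᵥ a + ∑ i, l i * u i) (piGaussian ι) :=
    (integrable_const _).add hI1
  rw [hexp]
  refine ⟨hI3.add hI2, ?_⟩
  rw [integral_add hI3 hI2, integral_add (integrable_const _) hI1,
    integral_finsetSum _ hi1, integral_finsetSum _ hi3]
  simp_rw [fun i => integral_finsetSum _ (hi2 i), integral_const_mul, integral_eval_piGaussian,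
    integral_mul_piGaussian]
  simp [one_apply, trace]

/-- The inverse moment of a chi-squared variable with `m` degrees of freedom. -/
lemma integrable_inv_piGaussian_and_integral {m : ℕ} (hm : 2 < m) :
    Integrable (fun w => (w ⬝ᵥ w)⁻¹) (piGaussian (Fin m)) ∧
    ∫ w, (w ⬝ᵥ w)⁻¹ ∂piGaussian (Fin m) = ((m : ℝ) - 2)⁻¹ := by
  have : Nonempty (Fin m) := ⟨⟨0, by omega⟩⟩
  set c : ℝ := (√(2 * π))⁻¹ ^ m with hc
  set J : ℝ → ℝ := fun q => ∫ r in Set.Ioi (0 : ℝ), r ^ q * Real.exp (-(1 / 2) * r ^ (2 : ℝ)) with hJ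
  have hm' : (2 : ℝ) < m := by exact_mod_cast hm
  have hJrec : J (m - 1) = (m - 2) * J (m - 3) := by
    simp only [hJ]
    rw [integral_rpow_mul_exp_neg_mul_rpow (by norm_num) (by linarith) (by norm_num),
      integral_rpow_mul_exp_neg_mul_rpow (by norm_num) (by linarith) (by norm_num),
      show ((m : ℝ) - 1 + 1) / 2 = (m - 3 + 1) / 2 + 1 by ring,
      Real.Gamma_add_one (by linarith),
      show -((m : ℝ) - 1 + 1) / 2 = -(m - 3 + 1) / 2 - 1 by ring,
      Real.rpow_sub_one (by norm_num)]
    ring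
  have hmp := (PiLp.volume_preserving_ofLp (Fin m))
  have hnorm : ∀ x : EuclideanSpace ℝ (Fin m), x.ofLp ⬝ᵥ x.ofLp = ‖x‖ ^ 2 := fun x => by
    rw [EuclideanSpace.real_norm_sq_eq, dotProduct]
    simp only [sq]
  set k : ℝ := m * (volume : Measure (EuclideanSpace ℝ (Fin m))).real (Metric.ball 0 1) with hk
  have hemb : MeasurableEmbedding (WithLp.ofLp (p := 2) (V := Fin m → ℝ)) :=
    (MeasurableEquiv.toLp 2 (Fin m → ℝ)).symm.measurableEmbedding
  have hrad : ∀ (f : ℝ → ℝ) (q : ℝ),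
      (∀ r, 0 < r → r ^ (m - 1) * (c * Real.exp (-r ^ 2 / 2) * f (r ^ 2))
        = c * (r ^ q * Real.exp (-(1 / 2) * r ^ (2 : ℝ)))) → -1 < q →
      Integrable (fun w => f (w ⬝ᵥ w)) (piGaussian (Fin m)) ∧
      ∫ w, f (w ⬝ᵥ w) ∂piGaussian (Fin m) = k * (c * J q) := by
    intro f q hf hq
    rw [integrable_piGaussian_iff, integral_piGaussian]
    simp only [prod_gaussianPDFReal, Fintype.card_fin, ← hc]
    rw [← hmp.integrable_comp_emb hemb, ← hmp.integral_comp hemb]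
    simp only [Function.comp_def, hnorm]
    have hint : IntegrableOn (fun r : ℝ => c * (r ^ q * Real.exp (-(1 / 2) * r ^ (2 : ℝ))))
        (Set.Ioi 0) := by
      simpa [IntegrableOn] using
        (integrableOn_rpow_mul_exp_neg_mul_sq (b := 1 / 2) (by norm_num) hq).const_mul c
    constructor
    · refine (integrable_fun_norm_addHaar volume
        (f := fun r => c * Real.exp (-r ^ 2 / 2) * f (r ^ 2))).mpr ?_
      rw [finrank_euclideanSpace_fin]
      refine hint.congr_fun (fun r hr => ?_) measurableSet_Ioi
      simpa using (hf r hr).symm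
    · rw [integral_fun_norm_addHaar volume
        (fun r => c * Real.exp (-r ^ 2 / 2) * f (r ^ 2)), finrank_euclideanSpace_fin,
        setIntegral_congr_fun (g := fun r => c * (r ^ q * Real.exp (-(1 / 2) * r ^ (2 : ℝ))))
          measurableSet_Ioi (fun r hr => by simpa using hf r hr), integral_const_mul]
      simp [hk, hJ, mul_assoc]
  have h1 := hrad (fun _ => 1) (m - 1) (fun r hr => by
    rw [← Real.rpow_natCast, Nat.cast_sub (by omega)]
    norm_num
    ring_nf) (by linarith)
  have h2 := hrad (fun x => x⁻¹) (m - 3) (fun r hr => by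
    rw [← Real.rpow_natCast, Nat.cast_sub (by omega),
      show ((m : ℝ) - (1 : ℕ)) = (m - 3) + (2 : ℕ) by push_cast; ring, Real.rpow_add_natCast hr.ne']
    norm_num
    field_simp) (by linarith)
  refine ⟨h2.1, ?_⟩
  have h1' := h1.2
  rw [hJrec] at h1'
  simp only [integral_const, probReal_univ, smul_eq_mul, mul_one] at h1'
  rw [h2.2]
  refine eq_inv_of_mul_eq_one_left ?_
  linear_combination -h1'

open scoped MatrixOrder in
lemma Matrix.PosDef.exists_eq_transpose_mul_self {ι : Type*} [Fintype ι] [DecidableEq ι]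
    {M : Matrix ι ι ℝ} (hM : M.PosDef) : ∃ B : Matrix ι ι ℝ, IsUnit B.det ∧ M = Bᵀ * B := by
  obtain ⟨B, hB, h⟩ := CStarAlgebra.isStrictlyPositive_iff_eq_star_mul_self.mp
    hM.isStrictlyPositive
  refine ⟨B, (isUnit_iff_isUnit_det B).mp hB, ?_⟩
  rw [h, star_eq_conjTranspose, conjTranspose_eq_transpose_of_trivial]

lemma Matrix.mulVec_injective_of_rank_eq {n p : ℕ} {X : Matrix (Fin n) (Fin p) ℝ}
    (hX : X.rank = p) : Function.Injective X.mulVec := by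
  have h := X.mulVecLin.finrank_range_add_finrank_ker
  rw [← Matrix.rank, hX, Module.finrank_fin_fun] at h
  have hker : LinearMap.ker X.mulVecLin = ⊥ := Submodule.finrank_eq_zero.mp (by omega)
  exact LinearMap.ker_eq_bot.mp hker

lemma Matrix.PosDef.transpose_mul_mul_same_of_rank_eq {n p : ℕ} {K : Matrix (Fin n) (Fin n) ℝ}
    (hK : K.PosDef) {X : Matrix (Fin n) (Fin p) ℝ} (hX : X.rank = p) : (Xᵀ * K * X).PosDef := by
  simpa [conjTranspose_eq_transpose_of_trivial] using
    hK.conjTranspose_mul_mul_same (mulVec_injective_of_rank_eq hX)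

/-- A system of columns that is orthonormal for the inner product given by a positive definite
matrix extends to an orthonormal basis. -/
lemma Matrix.PosDef.exists_orthonormal_complement {n p m : ℕ} (hn : p + m = n)
    {K : Matrix (Fin n) (Fin n) ℝ} (hK : K.PosDef) {U : Matrix (Fin n) (Fin p) ℝ}
    (hU : Uᵀ * K * U = 1) :
    ∃ N : Matrix (Fin n) (Fin m) ℝ, Nᵀ * K * N = 1 ∧ Uᵀ * K * N = 0 ∧ Nᵀ * K * U = 0 := by
  obtain ⟨B, hB, rfl⟩ := hK.exists_eq_transpose_mul_self
  let v : Fin p ⊕ Fin m → EuclideanSpace ℝ (Fin n) :=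
    Sum.elim (fun i => WithLp.toLp 2 ((B * U)ᵀ i)) 0
  have hinner : ∀ x y : EuclideanSpace ℝ (Fin n), inner ℝ x y = x.ofLp ⬝ᵥ y.ofLp := fun x y => by
    rw [EuclideanSpace.inner_eq_star_dotProduct, star_trivial, dotProduct_comm]
  have hv : Orthonormal ℝ ((Set.range Sum.inl).domRestrict v) := by
    rw [orthonormal_iff_ite]
    rintro ⟨_, i, rfl⟩ ⟨_, j, rfl⟩
    have h := congrFun (congrFun hU i) j
    rw [show Uᵀ * (Bᵀ * B) * U = (B * U)ᵀ * (B * U) by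
      simp only [transpose_mul, Matrix.mul_assoc]] at h
    rw [hinner]
    refine (Eq.trans (b := ((B * U)ᵀ * (B * U)) i j) rfl h).trans ?_
    rw [one_apply]
    exact if_congr ⟨fun h => Subtype.ext (congrArg Sum.inl h),
      fun h => Sum.inl_injective (congrArg Subtype.val h)⟩ rfl rfl
  obtain ⟨b, hb⟩ := hv.exists_orthonormalBasis_extension_of_card_eq (by simp [hn])
  let G : Matrix (Fin n) (Fin m) ℝ := of fun i j => b (Sum.inr j) i
  have hBG : B * (B⁻¹ * G) = G := mul_nonsing_inv_cancel_left _ _ hB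
  have horth := orthonormal_iff_ite.mp b.orthonormal
  simp only [hinner] at horth
  have hGG : Gᵀ * G = 1 := by
    ext i j
    simpa [one_apply] using! horth (Sum.inr i) (Sum.inr j)
  have hUG : (B * U)ᵀ * G = 0 := by
    ext i j
    have h := horth (Sum.inl i) (Sum.inr j)
    rw [hb _ ⟨i, rfl⟩] at h
    exact h.trans (by simp)
  refine ⟨B⁻¹ * G, ?_, ?_, ?_⟩
  · rw [← hGG, ← Matrix.mul_assoc _ _ B, ← transpose_mul, Matrix.mul_assoc, hBG]
  · rw [← hUG, ← Matrix.mul_assoc _ _ B, ← transpose_mul, Matrix.mul_assoc, hBG]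
  · rw [← Matrix.mul_assoc _ _ B, ← transpose_mul, Matrix.mul_assoc, hBG,
      ← transpose_transpose (B * U), ← transpose_mul, hUG, transpose_zero]

lemma measurePreserving_comp_equiv_piGaussian {ι κ : Type*} [Fintype ι] [Fintype κ]
    (e : ι ≃ κ) :
    MeasurePreserving (MeasurableEquiv.piCongrLeft (fun _ : κ => ℝ) e)
      (piGaussian ι) (piGaussian κ) :=
  measurePreserving_piCongrLeft (fun _ : κ => gaussianReal 0 1) e

/-- A Gaussian integral split along two complementary blocks of orthonormal coordinates. -/
lemma integral_mul_gaussPdf_blocks {n p m : ℕ} (hn : p + m = n) (f : (Fin n → ℝ) → ℝ)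
    (μ : Fin n → ℝ) {S : Matrix (Fin n) (Fin n) ℝ} (hS : S.PosDef) {U : Matrix (Fin n) (Fin p) ℝ}
    {N : Matrix (Fin n) (Fin m) ℝ} (hU : Uᵀ * S⁻¹ * U = 1) (hN : Nᵀ * S⁻¹ * N = 1)
    (hUN : Uᵀ * S⁻¹ * N = 0) (hNU : Nᵀ * S⁻¹ * U = 0) :
    ∫ y, f y * gaussPdf μ S y
      = ∫ z : (Fin p → ℝ) × (Fin m → ℝ), f (μ + (U *ᵥ z.1 + N *ᵥ z.2))
          ∂(piGaussian (Fin p)).prod (piGaussian (Fin m)) := by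
  let e : Fin p ⊕ Fin m ≃ Fin n := finSumFinEquiv.trans (finCongr hn)
  let T : Matrix (Fin n) (Fin n) ℝ := (fromCols U N).submatrix id e.symm
  have hSd : IsUnit S.det := hS.det_pos.ne'.isUnit
  have h1 : (Tᵀ * S⁻¹) * T = 1 := by
    have h : (fromCols U N)ᵀ * S⁻¹ * fromCols U N = 1 := by
      rw [transpose_fromCols, fromRows_mul, fromRows_mul_fromCols, hU, hN, hUN, hNU,
        fromBlocks_one]
    ext i j
    have h' := congrFun (congrFun h (e.symm i)) (e.symm j)
    exact h'.trans (by simp [one_apply])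
  have hT : T * Tᵀ = S := by
    have h2 := mul_eq_one_comm.mp h1
    rw [← Matrix.mul_assoc] at h2
    rw [← Matrix.mul_one (T * Tᵀ), ← nonsing_inv_mul _ hSd, ← Matrix.mul_assoc, h2,
      Matrix.one_mul]
  rw [integral_mul_gaussPdf f μ hT hS.det_pos.ne',
    ← (measurePreserving_comp_equiv_piGaussian e).integral_comp'
      (g := fun z => f (μ + T *ᵥ z)),
    piGaussian, ← (measurePreserving_sumPiEquivProdPi_symm
      (fun _ : Fin p ⊕ Fin m => gaussianReal 0 1)).integral_comp']
  congr 1 with z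
  congr 2
  ext i
  simp only [mulVec, dotProduct, Pi.add_apply, T]
  rw [← e.sum_comp, Fintype.sum_sum_type]
  simp only [MeasurableEquiv.coe_piCongrLeft, Equiv.piCongrLeft_apply_apply, submatrix_apply,
    Equiv.symm_apply_apply, id]
  rfl

lemma ae_dotProduct_self_ne_zero_piGaussian {m : ℕ} (hm : 0 < m) :
    ∀ᵐ w ∂piGaussian (Fin m), w ⬝ᵥ w ≠ 0 := by
  have : Nonempty (Fin m) := ⟨⟨0, hm⟩⟩
  have h : ∀ᵐ w : Fin m → ℝ, w ≠ 0 := by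
    simp [ae_iff]
  rw [piGaussian_eq_withDensity]
  filter_upwards [(withDensity_absolutelyContinuous _ _).ae_le h] with w hw
  exact fun h0 => hw (dotProduct_self_eq_zero.mp h0)

/-- Expectation of `1 + q(u) / |w|²` for independent standard Gaussian vectors. -/
lemma integral_prod_ratio {p m : ℕ} (hm : 2 < m) (c k : ℝ) (hk : k ≠ 0) {q : (Fin p → ℝ) → ℝ}
    (hq : Integrable q (piGaussian (Fin p))) :
    ∫ z : (Fin p → ℝ) × (Fin m → ℝ), (k * (z.2 ⬝ᵥ z.2) + q z.1) / (k * (z.2 ⬝ᵥ z.2) / c)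
          ∂(piGaussian (Fin p)).prod (piGaussian (Fin m))
      = c + c / (k * (m - 2)) * ∫ u, q u ∂piGaussian (Fin p) := by
  obtain ⟨hint, hval⟩ := integrable_inv_piGaussian_and_integral hm
  have hae : ∀ᵐ z ∂(piGaussian (Fin p)).prod (piGaussian (Fin m)), z.2 ⬝ᵥ z.2 ≠ 0 :=
    Measure.quasiMeasurePreserving_snd.ae (ae_dotProduct_self_ne_zero_piGaussian (by omega))
  rw [integral_congr_ae (g := fun z => c + c / k * (q z.1 * (z.2 ⬝ᵥ z.2)⁻¹))]
  · rw [integral_add (integrable_const _) ((hq.mul_prod hint).const_mul _), integral_const_mul,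
      integral_prod_mul q fun w : Fin m → ℝ => (w ⬝ᵥ w)⁻¹, hval, integral_const, probReal_univ,
      one_smul, div_mul_eq_div_div]
    ring
  · filter_upwards [hae] with z hz
    field_simp

/-- The matrix of the quadratic form `yᵀ A y` restricted to the column space of `X`. -/
lemma gram_sub_eq {p : ℕ} {G W : Matrix (Fin p) (Fin p) ℝ} (hM : IsUnit (G + W⁻¹).det) :
    G - G * (G + W⁻¹)⁻¹ * G = G * (G + W⁻¹)⁻¹ * W⁻¹ := by
  have h : G = G * (G + W⁻¹)⁻¹ * (G + W⁻¹) := by rw [nonsing_inv_mul_cancel_right _ _ hM]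
  nth_rewrite 1 [h]
  rw [Matrix.mul_add, add_sub_cancel_left]

lemma dotProduct_mulVec_blocks {n p m : ℕ} {X : Matrix (Fin n) (Fin p) ℝ}
    {N : Matrix (Fin n) (Fin m) ℝ} {K : Matrix (Fin n) (Fin n) ℝ} {Q : Matrix (Fin p) (Fin p) ℝ}
    (hXX : Xᵀ * K * X = Q) (hNN : Nᵀ * K * N = 1) (hXN : Xᵀ * K * N = 0) (hNX : Nᵀ * K * X = 0)
    (a : Fin p → ℝ) (w : Fin m → ℝ) :
    (X *ᵥ a + N *ᵥ w) ⬝ᵥ K *ᵥ (X *ᵥ a + N *ᵥ w) = w ⬝ᵥ w + a ⬝ᵥ Q *ᵥ a := by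
  have key : ∀ {r t : ℕ} (R : Matrix (Fin n) (Fin r) ℝ) (T : Matrix (Fin n) (Fin t) ℝ)
      (x : Fin r → ℝ) (y : Fin t → ℝ),
      R *ᵥ x ⬝ᵥ K *ᵥ T *ᵥ y = x ⬝ᵥ (Rᵀ * K * T) *ᵥ y := fun R T x y => by
    rw [dotProduct_mulVec, vecMul_mulVec, ← dotProduct_mulVec, mulVec_mulVec]
  simp only [mulVec_add, add_dotProduct, dotProduct_add, key, hXX, hNN, hXN, hNX, zero_mulVec,
    one_mulVec, dotProduct_zero]
  ring

lemma trace_smul_transpose_mul_mul {ι : Type*} [Fintype ι] (s : ℝ) (C Q : Matrix ι ι ℝ) :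
    ((s • C)ᵀ * Q * (s • C)).trace = s * s * (Q * (C * Cᵀ)).trace := by
  rw [transpose_smul, Matrix.mul_smul, Matrix.smul_mul, Matrix.smul_mul, smul_smul, trace_smul,
    smul_eq_mul, Matrix.mul_assoc, trace_mul_comm, Matrix.mul_assoc]

lemma EpiEom_eq_traces {p n : ℕ} (X : (n : ℕ) → Matrix (Fin n) (Fin p) ℝ)
    (V : (n : ℕ) → Matrix (Fin n) (Fin n) ℝ) (hV : (V n).PosDef) (hX : (X n).rank = p)
    {W : Matrix (Fin p) (Fin p) ℝ} (hW : W.PosDef) {σ2 : ℝ} (hσ : 0 < σ2) (hn : p + 2 < n) :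
    EpiEom p X V W σ2 n
      = n + n / (σ2 * ((n : ℝ) - p - 2)) *
          (σ2 * (((X n)ᵀ * (V n)⁻¹ * X n + W⁻¹)⁻¹ * W⁻¹).trace
            + σ2 * ((X n)ᵀ * (V n)⁻¹ * X n
                * ((X n)ᵀ * (V n)⁻¹ * X n + W⁻¹)⁻¹).trace) := by
  obtain ⟨m, rfl⟩ : ∃ m, n = p + m := ⟨n - p, by omega⟩
  have hm : 2 < m := by omega
  unfold EpiEom
  generalize X (p + m) = X at *
  generalize V (p + m) = V at *
  set G : Matrix (Fin p) (Fin p) ℝ := Xᵀ * V⁻¹ * X with hG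
  have hGpos : G.PosDef := hV.inv.transpose_mul_mul_same_of_rank_eq hX
  have hGu : IsUnit G.det := hGpos.det_pos.ne'.isUnit
  have hMu : IsUnit (G + W⁻¹).det := (hGpos.add hW.inv).det_pos.ne'.isUnit
  have hWu : IsUnit W.det := hW.det_pos.ne'.isUnit
  set s : ℝ := √σ2
  have hss : s * s = σ2 := Real.mul_self_sqrt hσ.le
  have hs0 : s ≠ 0 := (Real.sqrt_pos.mpr hσ).ne'
  obtain ⟨D, hD, hGD⟩ := hGpos.exists_eq_transpose_mul_self
  obtain ⟨R, hR, hWR⟩ := hW.exists_eq_transpose_mul_self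
  have hDt : IsUnit Dᵀ.det := by rwa [det_transpose]
  have hDG : (D⁻¹)ᵀ * G * D⁻¹ = 1 := by
    rw [hGD, ← Matrix.mul_assoc, transpose_nonsing_inv, nonsing_inv_mul _ hDt, Matrix.one_mul,
      mul_nonsing_inv _ hD]
  have hDD : D⁻¹ * (D⁻¹)ᵀ = G⁻¹ := by
    rw [hGD, Matrix.mul_inv_rev, transpose_nonsing_inv]
  obtain ⟨N, hNN, hUN, hNU⟩ := hV.inv.exists_orthonormal_complement (U := X * D⁻¹) (m := m) rfl
    (by rw [transpose_mul, ← hDG, hG]; simp only [Matrix.mul_assoc])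
  have hDD1 : D⁻¹ * D = 1 := nonsing_inv_mul _ hD
  have hNX : Nᵀ * V⁻¹ * X = 0 := by
    rw [← Matrix.mul_one X, ← hDD1, ← Matrix.mul_assoc, ← Matrix.mul_assoc,
      Matrix.mul_assoc _ X, hNU, Matrix.zero_mul]
  have hXN : Xᵀ * V⁻¹ * N = 0 := by
    have h := congrArg transpose hNX
    have hVt : V⁻¹ᵀ = V⁻¹ := by
      simpa [conjTranspose_eq_transpose_of_trivial] using hV.inv.isHermitian.eq
    simpa [transpose_mul, hVt, Matrix.mul_assoc] using h
  set Q : Matrix (Fin p) (Fin p) ℝ := G - G * (G + W⁻¹)⁻¹ * G with hQ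
  have hsand : ∀ {r t : ℕ} (L : Matrix (Fin r) (Fin (p + m)) ℝ) (T : Matrix (Fin (p + m)) (Fin t) ℝ)
      (H : Matrix (Fin p) (Fin p) ℝ),
      L * (V⁻¹ - V⁻¹ * X * H * Xᵀ * V⁻¹) * T
        = L * V⁻¹ * T - L * V⁻¹ * X * H * (Xᵀ * V⁻¹ * T) := fun L T H => by
    simp only [Matrix.mul_sub, Matrix.sub_mul, Matrix.mul_assoc]
  have hA := dotProduct_mulVec_blocks (X := X) (N := N) (K := Amat X V W) (Q := Q)
    (by rw [Amat, hsand, ← hG]) (by rw [Amat, hsand, hNN, hNX]; simp)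
    (by rw [Amat, hsand, hXN]; simp) (by rw [Amat, hsand, hNX]; simp)
  have hP := dotProduct_mulVec_blocks (X := X) (N := N) (K := Pmat X V) (Q := 0)
    (by rw [Pmat, hsand, ← hG, mul_nonsing_inv _ hGu, Matrix.one_mul, sub_self])
    (by rw [Pmat, hsand, hNN, hNX]; simp)
    (by rw [Pmat, hsand, hXN]; simp) (by rw [Pmat, hsand, hNX]; simp)
  have hinv : (σ2 • V)⁻¹ = σ2⁻¹ • V⁻¹ := by
    have : Invertible σ2 := invertibleOfNonzero hσ.ne'
    rw [inv_smul _ σ2 hV.det_pos.ne'.isUnit, invOf_eq_inv]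
  have hscale : ∀ {r t : ℕ} (L : Matrix (Fin (p + m)) (Fin r) ℝ)
      (T : Matrix (Fin (p + m)) (Fin t) ℝ),
      (s • L)ᵀ * (σ2 • V)⁻¹ * (s • T) = Lᵀ * V⁻¹ * T := fun L T => by
    rw [hinv, transpose_smul]
    simp only [Matrix.smul_mul, Matrix.mul_smul, smul_smul]
    rw [show s * (σ2⁻¹ * s) = 1 by rw [← hss]; field_simp, one_smul]
  have hinner : ∀ β : Fin p → ℝ,
      ∫ y, ((y ⬝ᵥ (Amat X V W).mulVec y) / (y ⬝ᵥ (Pmat X V).mulVec y / ((p + m : ℕ) : ℝ)))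
          * gaussPdf (X.mulVec β) (σ2 • V) y
        = ((p + m : ℕ) : ℝ) + ((p + m : ℕ) : ℝ) / (σ2 * (m - 2))
            * (β ⬝ᵥ Q *ᵥ β + σ2 * (Q * G⁻¹).trace) := by
    intro β
    obtain ⟨hqi, hqv⟩ := integrable_quadratic_piGaussian_and_integral β (s • D⁻¹) Q
    rw [integral_mul_gaussPdf_blocks (n := p + m) (m := m) rfl
      (fun y => (y ⬝ᵥ (Amat X V W).mulVec y) / (y ⬝ᵥ (Pmat X V).mulVec y / ((p + m : ℕ) : ℝ))) _
      (hV.smul hσ) (U := s • (X * D⁻¹)) (N := s • N)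
      (by rw [hscale, transpose_mul, ← hDG, hG]; simp only [Matrix.mul_assoc])
      (by rw [hscale, hNN]) (by rw [hscale, hUN]) (by rw [hscale, hNU])]
    have hy : ∀ z : (Fin p → ℝ) × (Fin m → ℝ),
        X *ᵥ β + ((s • (X * D⁻¹)) *ᵥ z.1 + (s • N) *ᵥ z.2)
          = X *ᵥ (β + (s • D⁻¹) *ᵥ z.1) + N *ᵥ (s • z.2) := fun z => by
      rw [mulVec_add, mulVec_mulVec, Matrix.mul_smul, mulVec_smul, smul_mulVec s N,
        add_assoc]
    simp only [hy, hA, hP, zero_mulVec, dotProduct_zero, add_zero, smul_dotProduct,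
      dotProduct_smul, smul_eq_mul]
    simp only [← mul_assoc, hss]
    rw [integral_prod_ratio hm _ _ hσ.ne' hqi, hqv]
    congr 3
    rw [trace_smul_transpose_mul_mul, hss, hDD]
  simp only [hinner]
  obtain ⟨hqi, hqv⟩ := integrable_quadratic_piGaussian_and_integral 0 (s • Rᵀ) Q
  have hqc : Integrable (fun u => (0 + (s • Rᵀ) *ᵥ u) ⬝ᵥ Q *ᵥ (0 + (s • Rᵀ) *ᵥ u)
      + σ2 * (Q * G⁻¹).trace) (piGaussian (Fin p)) := hqi.add (integrable_const _)
  rw [integral_mul_gaussPdf _ _ (T := s • Rᵀ) (by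
      rw [transpose_smul, Matrix.smul_mul, Matrix.mul_smul, smul_smul, hss, transpose_transpose,
        hWR]) (hW.smul hσ).det_pos.ne',
    integral_add (integrable_const _) (hqc.const_mul _), integral_const_mul,
    integral_add hqi (integrable_const _), hqv]
  simp only [integral_const, probReal_univ, one_smul, mulVec_zero, dotProduct_zero, zero_add]
  have ht1 : ((s • Rᵀ)ᵀ * Q * (s • Rᵀ)).trace = σ2 * (G * (G + W⁻¹)⁻¹).trace := by
    rw [trace_smul_transpose_mul_mul, hss, transpose_transpose, ← hWR, hQ, gram_sub_eq hMu,
      nonsing_inv_mul_cancel_right _ _ hWu]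
  have ht2 : (Q * G⁻¹).trace = ((G + W⁻¹)⁻¹ * W⁻¹).trace := by
    rw [hQ, gram_sub_eq hMu, trace_mul_comm, ← Matrix.mul_assoc, ← Matrix.mul_assoc,
      nonsing_inv_mul _ hGu, Matrix.one_mul]
  rw [ht1, ht2, show (((p + m : ℕ) : ℝ) - p - 2) = m - 2 by push_cast; ring]
  ring

lemma EpiEom_eq {p n : ℕ} (X : (n : ℕ) → Matrix (Fin n) (Fin p) ℝ)
    (V : (n : ℕ) → Matrix (Fin n) (Fin n) ℝ) (hV : (V n).PosDef) (hX : (X n).rank = p)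
    {W : Matrix (Fin p) (Fin p) ℝ} (hW : W.PosDef) {σ2 : ℝ} (hσ : 0 < σ2) (hn : p + 2 < n) :
    EpiEom p X V W σ2 n = n + n / ((n : ℝ) - p - 2) * p := by
  rw [EpiEom_eq_traces X V hV hX hW hσ hn]
  set G : Matrix (Fin p) (Fin p) ℝ := (X n)ᵀ * (V n)⁻¹ * X n with hG
  have hGpos : G.PosDef := hV.inv.transpose_mul_mul_same_of_rank_eq hX
  have hMu : IsUnit (G + W⁻¹).det := (hGpos.add hW.inv).det_pos.ne'.isUnit
  have htr : ((G + W⁻¹)⁻¹ * W⁻¹).trace + (G * (G + W⁻¹)⁻¹).trace = p := by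
    rw [trace_mul_comm G, ← trace_add, ← Matrix.mul_add, add_comm W⁻¹, nonsing_inv_mul _ hMu]
    simp
  rw [← mul_add, htr, div_mul_eq_div_div]
  field_simp

/-- In the normal linear regression model with normal prior, the quantity
`E_π E_ω (yᵀA y / σ̂²)` equals
`n + n/(σ²(n-p-2)) (σ² tr[(XᵀV⁻¹X + W⁻¹)⁻¹W⁻¹] + σ² tr[XᵀV⁻¹X(XᵀV⁻¹X + W⁻¹)⁻¹])`,
and consequently, if `n⁻¹XₙᵀVₙ⁻¹Xₙ` converges to a positive definite matrix,
then `E_π E_ω (yᵀA y / σ̂²) - n → p`. -/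
theorem stmt_14 (p : ℕ) (X : (n : ℕ) → Matrix (Fin n) (Fin p) ℝ)
    (V : (n : ℕ) → Matrix (Fin n) (Fin n) ℝ) (hV : ∀ n, (V n).PosDef)
    (hX : ∀ n, p + 2 < n → (X n).rank = p)
    (W : Matrix (Fin p) (Fin p) ℝ) (hW : W.PosDef) (σ2 : ℝ) (hσ : 0 < σ2) :
    (∀ n : ℕ, p + 2 < n →
      EpiEom p X V W σ2 n
        = n + n / (σ2 * ((n : ℝ) - p - 2)) *
            (σ2 * (((X n)ᵀ * (V n)⁻¹ * X n + W⁻¹)⁻¹ * W⁻¹).trace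
              + σ2 * ((X n)ᵀ * (V n)⁻¹ * X n
                  * ((X n)ᵀ * (V n)⁻¹ * X n + W⁻¹)⁻¹).trace)) ∧
    (∀ L : Matrix (Fin p) (Fin p) ℝ, L.PosDef →
      Tendsto (fun n : ℕ => (n : ℝ)⁻¹ • ((X n)ᵀ * (V n)⁻¹ * X n)) atTop (𝓝 L) →
      Tendsto (fun n : ℕ => EpiEom p X V W σ2 n - n) atTop (𝓝 (p : ℝ))) := by
  refine ⟨fun n hn => EpiEom_eq_traces X V (hV n) (hX n hn) hW hσ hn, fun _ _ _ => ?_⟩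
  have h1 : Tendsto (fun n : ℕ => ((n : ℝ) - (p + 2))⁻¹) atTop (𝓝 0) :=
    tendsto_inv_atTop_zero.comp
      (tendsto_atTop_add_const_right _ _ tendsto_natCast_atTop_atTop)
  have h2 : Tendsto (fun n : ℕ => (p : ℝ) + (p + 2) * p * ((n : ℝ) - (p + 2))⁻¹) atTop
      (𝓝 (p : ℝ)) := by
    simpa using (h1.const_mul (((p : ℝ) + 2) * p)).const_add (p : ℝ)
  refine h2.congr' ?_
  filter_upwards [eventually_gt_atTop (p + 2)] with n hn
  have hn' : (p : ℝ) + 2 < n := by exact_mod_cast hn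
  have hne : (n : ℝ) - (p + 2) ≠ 0 := by linarith
  rw [EpiEom_eq X V (hV n) (hX n hn) hW hσ hn, sub_sub]
  field_simp
  ring
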